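/- For an ample groupoid 𝒢, the following are equivalent: (1) 𝒢 is the union of a family of quasi-compact open subgroupoids directed under inclusion; (2) 𝒢 is the union of a family of uniformly bounded open subgroupoids directed under inclusion; (3) the inverse semigroup of all compact bisections of 𝒢 is locally finite. -/

import Mathlib

universe u

/-- The algebraic operations of a groupoid (identified with its set of arrows):
a (partially meaningful) composition `gmul` and an inversion `ginv`.  The product
`gmul g h` is only required to behave like composition when `g` and `h` are
composable, i.e. when `src g = rng h`. -/
class GroupoidOps (G : Type u) where
  gmul : G → G → G
  ginv : G → G

namespace GroupoidOps

variable {G : Type u} [GroupoidOps G]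

/-- The source map `s g = g⁻¹ g`. -/
def src (g : G) : G := gmul (ginv g) g

/-- The range map `r g = g g⁻¹`. -/
def rng (g : G) : G := gmul g (ginv g)

/-- The unit space `𝒢⁰`: the set of identity arrows. -/
def unitSpace (G : Type u) [GroupoidOps G] : Set G := {x : G | src x = x}

end GroupoidOps

open GroupoidOps

/-- A topological groupoid: a groupoid `G`, identified with its arrow space, equipped
with a topology such that inversion is continuous and composition is continuous on the
set of composable pairs. -/
class TopologicalGroupoid (G : Type u) extends TopologicalSpace G, GroupoidOps G where
  ginv_ginv : ∀ g : G, ginv (ginv g) = g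
  gmul_src : ∀ g : G, gmul g (src g) = g
  rng_gmul : ∀ g : G, gmul (rng g) g = g
  gmul_assoc : ∀ g h k : G, src g = rng h → src h = rng k →
    gmul (gmul g h) k = gmul g (gmul h k)
  src_gmul : ∀ g h : G, src g = rng h → src (gmul g h) = src h
  rng_gmul_comp : ∀ g h : G, src g = rng h → rng (gmul g h) = rng g
  ginv_gmul : ∀ g h : G, src g = rng h → ginv (gmul g h) = gmul (ginv h) (ginv g)
  ginv_unit : ∀ x : G, src x = x → ginv x = x
  src_src : ∀ g : G, src (src g) = src g
  src_rng : ∀ g : G, src (rng g) = rng g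
  continuous_ginv : Continuous (ginv : G → G)
  continuous_gmul : Continuous fun p : {p : G × G // src p.1 = rng p.2} => gmul p.1.1 p.1.2

/-- An ample groupoid: a topological groupoid (not necessarily Hausdorff) whose unit
space is locally compact, Hausdorff and totally disconnected in the subspace topology,
and whose source map, viewed as a map `G → 𝒢⁰`, is a local homeomorphism. -/
class AmpleGroupoid (G : Type u) extends TopologicalGroupoid G where
  t2_unitSpace : T2Space (unitSpace G)
  locallyCompact_unitSpace : LocallyCompactSpace (unitSpace G)
  totallyDisconnected_unitSpace : TotallyDisconnectedSpace (unitSpace G)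
  isLocalHomeomorph_src :
    IsLocalHomeomorph fun g : G => (⟨src g, TopologicalGroupoid.src_src g⟩ : unitSpace G)

namespace TopologicalGroupoid

variable {G : Type u} [TopologicalGroupoid G]

/-- A bisection: an open subset on which both the source and the range map are injective. -/
def IsBisection (U : Set G) : Prop :=
  IsOpen U ∧ Set.InjOn (src : G → G) U ∧ Set.InjOn (rng : G → G) U

/-- A compact bisection: a bisection which is compact
(quasi-compact and Hausdorff in the subspace topology). -/
def IsCompactBisection (U : Set G) : Prop :=
  IsBisection U ∧ IsCompact U ∧ T2Space U

/-- Setwise inverse `U⁻¹ = { u⁻¹ : u ∈ U }`. -/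
def setInv (U : Set G) : Set G := ginv '' U

/-- Setwise product `UV = { uv : u ∈ U, v ∈ V, s(u) = r(v) }`. -/
def setMul (U V : Set G) : Set G :=
  {x : G | ∃ u ∈ U, ∃ v ∈ V, src u = rng v ∧ x = gmul u v}

/-- A subgroupoid: a subset closed under inversion and (composable) composition. -/
def IsSubgroupoid (H : Set G) : Prop :=
  (∀ g ∈ H, ginv g ∈ H) ∧ ∀ g ∈ H, ∀ h ∈ H, src g = rng h → gmul g h ∈ H

/-- A groupoid is principal if every isotropy element is a unit. -/
def IsPrincipal (G : Type u) [TopologicalGroupoid G] : Prop :=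
  ∀ g : G, src g = rng g → g ∈ unitSpace G

/-- The orbit of `x`, namely `r(s⁻¹(x))`. -/
def orbit (x : G) : Set G := {y : G | ∃ g : G, src g = x ∧ rng g = y}

/-- A subset of the unit space is invariant if it is a union of orbits. -/
def IsInvariant (U : Set G) : Prop := ∀ g : G, src g ∈ U → rng g ∈ U

/-- An inverse semigroup of compact bisections: a nonempty collection of compact
bisections closed under setwise product and setwise inverse. -/
def IsInvSemigroupOfCompactBisections (S : Set (Set G)) : Prop :=
  S.Nonempty ∧ (∀ U ∈ S, IsCompactBisection U) ∧
    (∀ U ∈ S, setInv U ∈ S) ∧ ∀ U ∈ S, ∀ V ∈ S, setMul U V ∈ S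

/-- The orbit equivalence relation `𝓡` on the unit space. -/
def orbitRel (G : Type u) [TopologicalGroupoid G] :
    unitSpace G → unitSpace G → Prop :=
  fun x y => ∃ g : G, src g = (x : G) ∧ rng g = (y : G)

end TopologicalGroupoid

open TopologicalGroupoid

/-- A topological groupoid (here: a subgroupoid `H`, with the induced structure) is
uniformly bounded if there is an integer `M ≥ 1` bounding the size of every fiber
`r⁻¹(x) ∩ H` over a unit `x` of `H`. -/
def UniformlyBoundedSubgroupoid {G : Type u} [TopologicalGroupoid G] (H : Set G) : Prop :=
  ∃ M : ℕ, 1 ≤ M ∧ ∀ x ∈ H, src x = x →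
    {g ∈ H | rng g = x}.Finite ∧ {g ∈ H | rng g = x}.ncard ≤ M

/-- The inverse subsemigroup (of subsets of `G` under setwise product and inverse)
generated by a collection `X`. -/
def genInvSemigroup {G : Type u} [TopologicalGroupoid G] (X : Set (Set G)) : Set (Set G) :=
  ⋂₀ {S : Set (Set G) | X ⊆ S ∧ (∀ U ∈ S, TopologicalGroupoid.setInv U ∈ S) ∧
      ∀ U ∈ S, ∀ V ∈ S, TopologicalGroupoid.setMul U V ∈ S}

namespace TopologicalGroupoid

section Algebra

variable {G : Type u} [TopologicalGroupoid G]

theorem src_ginv (g : G) : src (ginv g) = rng g := by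
  simp only [src, rng, ginv_ginv]

theorem rng_ginv (g : G) : rng (ginv g) = src g := by
  simp only [src, rng, ginv_ginv]

theorem rng_src (g : G) : rng (src g) = src g := by
  rw [← src_ginv, ginv_unit _ (src_src g), src_src]

theorem ginv_gmul_gmul {g h : G} (hgh : src g = rng h) : gmul (ginv g) (gmul g h) = h := by
  rw [← gmul_assoc _ _ _ (src_ginv g) hgh]
  change gmul (src g) h = h
  rw [hgh, rng_gmul]

theorem gmul_ginv_gmul {g h : G} (hgh : rng g = rng h) : gmul g (gmul (ginv g) h) = h := by
  rw [← gmul_assoc _ _ _ (rng_ginv g).symm (by rw [src_ginv, hgh])]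
  change gmul (rng g) h = h
  rw [hgh, rng_gmul]

theorem injOn_src_setMul {U V : Set G} (hU : Set.InjOn (src : G → G) U)
    (hV : Set.InjOn (src : G → G) V) : Set.InjOn (src : G → G) (setMul U V) := by
  rintro _ ⟨u, hu, v, hv, huv, rfl⟩ _ ⟨u', hu', v', hv', huv', rfl⟩ h
  rw [src_gmul _ _ huv, src_gmul _ _ huv'] at h
  obtain rfl := hV hv hv' h
  rw [hU hu hu' (huv.trans huv'.symm)]

theorem injOn_rng_setMul {U V : Set G} (hU : Set.InjOn (rng : G → G) U)
    (hV : Set.InjOn (rng : G → G) V) : Set.InjOn (rng : G → G) (setMul U V) := by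
  rintro _ ⟨u, hu, v, hv, huv, rfl⟩ _ ⟨u', hu', v', hv', huv', rfl⟩ h
  rw [rng_gmul_comp _ _ huv, rng_gmul_comp _ _ huv'] at h
  obtain rfl := hU hu hu' h
  rw [hV hv hv' (huv.symm.trans huv')]

theorem injOn_src_setInv {U : Set G} (hU : Set.InjOn (rng : G → G) U) :
    Set.InjOn (src : G → G) (setInv U) := by
  rintro _ ⟨u, hu, rfl⟩ _ ⟨v, hv, rfl⟩ h
  rw [src_ginv, src_ginv] at h
  rw [hU hu hv h]

theorem injOn_rng_setInv {U : Set G} (hU : Set.InjOn (src : G → G) U) :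
    Set.InjOn (rng : G → G) (setInv U) := by
  rintro _ ⟨u, hu, rfl⟩ _ ⟨v, hv, rfl⟩ h
  rw [rng_ginv, rng_ginv] at h
  rw [hU hu hv h]

theorem setInv_eq_preimage (U : Set G) : setInv U = ginv ⁻¹' U :=
  congrFun (Set.image_eq_preimage_of_inverse ginv_ginv ginv_ginv) U

theorem subset_genInvSemigroup (X : Set (Set G)) : X ⊆ genInvSemigroup X :=
  Set.subset_sInter fun _ hS => hS.1

theorem genInvSemigroup_subset {X S : Set (Set G)} (hX : X ⊆ S)
    (hinv : ∀ U ∈ S, setInv U ∈ S) (hmul : ∀ U ∈ S, ∀ V ∈ S, setMul U V ∈ S) :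
    genInvSemigroup X ⊆ S :=
  Set.sInter_subset_of_mem ⟨hX, hinv, hmul⟩

theorem setInv_mem_genInvSemigroup {X : Set (Set G)} {U : Set G}
    (hU : U ∈ genInvSemigroup X) : setInv U ∈ genInvSemigroup X :=
  fun S hS => hS.2.1 U (hU S hS)

theorem setMul_mem_genInvSemigroup {X : Set (Set G)} {U V : Set G}
    (hU : U ∈ genInvSemigroup X) (hV : V ∈ genInvSemigroup X) :
    setMul U V ∈ genInvSemigroup X :=
  fun S hS => hS.2.2 U (hU S hS) V (hV S hS)

theorem genInvSemigroup_mono {X Y : Set (Set G)} (h : X ⊆ Y) :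
    genInvSemigroup X ⊆ genInvSemigroup Y :=
  genInvSemigroup_subset (h.trans (subset_genInvSemigroup Y))
    (fun _ => setInv_mem_genInvSemigroup) (fun _ hU _ hV => setMul_mem_genInvSemigroup hU hV)

theorem isSubgroupoid_sUnion_genInvSemigroup (X : Set (Set G)) :
    IsSubgroupoid (⋃₀ genInvSemigroup X) := by
  constructor
  · rintro g ⟨U, hU, hg⟩
    exact ⟨_, setInv_mem_genInvSemigroup hU, g, hg, rfl⟩
  · rintro g ⟨U, hU, hg⟩ h ⟨V, hV, hh⟩ hgh
    exact ⟨_, setMul_mem_genInvSemigroup hU hV, g, hg, h, hh, hgh, rfl⟩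

theorem IsSubgroupoid.src_mem {H : Set G} (hH : IsSubgroupoid H) {g : G} (hg : g ∈ H) :
    src g ∈ H :=
  hH.2 _ (hH.1 g hg) _ hg (src_ginv g)

/-- The relation induced by left multiplication by `W` on the arrows of `H` with source `x`,
labelled by `e`. -/
def leftMulRel {κ : Type*} (H : Set G) (e : G → κ) (x : G) (W : Set G) : Set (κ × κ) :=
  {p | ∃ h ∈ H, src h = x ∧ ∃ u ∈ W, src u = rng h ∧ e (gmul u h) = p.1 ∧ e h = p.2}

theorem leftMulRel_setInv {κ : Type*} {H : Set G} (hH : IsSubgroupoid H) (e : G → κ) (x : G)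
    {W : Set G} (hW : W ⊆ H) :
    leftMulRel H e x (setInv W) = Prod.swap ⁻¹' leftMulRel H e x W := by
  ext ⟨a, b⟩
  constructor
  · rintro ⟨h, hh, rfl, _, ⟨u, hu, rfl⟩, hs, rfl, rfl⟩
    have hs' : rng u = rng h := by rw [← hs, src_ginv]
    refine ⟨gmul (ginv u) h, hH.2 _ (hH.1 _ (hW hu)) _ hh hs, src_gmul _ _ hs, u, hu, ?_, ?_, rfl⟩
    · rw [rng_gmul_comp _ _ hs, rng_ginv]
    · rw [gmul_ginv_gmul hs']; rfl
  · rintro ⟨h, hh, rfl, u, hu, hs, h1, h2⟩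
    refine ⟨gmul u h, hH.2 _ (hW hu) _ hh hs, src_gmul _ _ hs, _, ⟨u, hu, rfl⟩, ?_, ?_, h1⟩
    · rw [rng_gmul_comp _ _ hs, src_ginv]
    · rw [ginv_gmul_gmul hs]; exact h2

theorem leftMulRel_setMul {κ : Type*} {H : Set G} (hH : IsSubgroupoid H) {e : G → κ}
    (he : ∀ g ∈ H, ∀ h ∈ H, src g = src h → e g = e h → g = h) (x : G)
    {V W : Set G} (hW : W ⊆ H) :
    leftMulRel H e x (setMul V W) =
      {p | ∃ c, (p.1, c) ∈ leftMulRel H e x V ∧ (c, p.2) ∈ leftMulRel H e x W} := by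
  ext ⟨a, b⟩
  constructor
  · rintro ⟨h, hh, rfl, _, ⟨v, hv, w, hw, hvw, rfl⟩, hs, rfl, rfl⟩
    rw [src_gmul _ _ hvw] at hs
    refine ⟨e (gmul w h), ⟨gmul w h, hH.2 _ (hW hw) _ hh hs, src_gmul _ _ hs, v, hv, ?_, ?_, rfl⟩,
      ⟨h, hh, rfl, w, hw, hs, rfl, rfl⟩⟩
    · rw [rng_gmul_comp _ _ hs, hvw]
    · rw [gmul_assoc _ _ _ hvw hs]
  · rintro ⟨c, ⟨k, hk, hkx, v, hv, hvk, h1, h2⟩, ⟨h, hh, hhx, w, hw, hwh, h3, h4⟩⟩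
    dsimp only at h1 h2 h3 h4
    have hkh : k = gmul w h := he _ hk _ (hH.2 _ (hW hw) _ hh hwh)
      (by rw [src_gmul _ _ hwh, hkx, hhx]) (h2.trans h3.symm)
    subst hkh
    rw [rng_gmul_comp _ _ hwh] at hvk
    refine ⟨h, hh, hhx, gmul v w, ⟨v, hv, w, hw, hvk, rfl⟩, ?_, ?_, h4⟩
    · rw [src_gmul _ _ hvk, hwh]
    · rw [gmul_assoc _ _ _ hvk hwh]; exact h1

theorem subset_of_leftMulRel_subset {κ : Type*} {H : Set G} (hH : IsSubgroupoid H) {e : G → κ}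
    (he : ∀ g ∈ H, ∀ h ∈ H, src g = src h → e g = e h → g = h)
    {V W : Set G} (hV : V ⊆ H) (hW : W ⊆ H)
    (hVW : ∀ x, leftMulRel H e x V ⊆ leftMulRel H e x W) : V ⊆ W := by
  intro g hg
  have hs : src g ∈ H := hH.src_mem (hV hg)
  obtain ⟨h, hh, hhx, u, hu, huh, h1, h2⟩ := hVW (src g)
    (show (e g, e (src g)) ∈ _ from
      ⟨src g, hs, src_src g, g, hg, (rng_src g).symm, by rw [gmul_src], rfl⟩)
  dsimp only at h1 h2
  obtain rfl := he _ hh _ hs (hhx.trans (src_src g).symm) h2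
  rw [rng_src] at huh
  rw [← huh, gmul_src] at h1
  rwa [← he _ (hW hu) _ (hV hg) huh h1]

theorem _root_.UniformlyBoundedSubgroupoid.exists_label {H : Set G} (hH : IsSubgroupoid H)
    (hb : UniformlyBoundedSubgroupoid H) : ∃ (M : ℕ) (e : G → Fin M),
      ∀ g ∈ H, ∀ h ∈ H, src g = src h → e g = e h → g = h := by
  obtain ⟨M, hM, hb⟩ := hb
  have : Nonempty (Fin M) := ⟨⟨0, hM⟩⟩
  have key : ∀ x : G, ∃ f : G → Fin M, Set.InjOn f {g ∈ H | src g = x} := by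
    intro x
    by_cases hx : ∃ g ∈ H, src g = x
    · obtain ⟨g, hg, rfl⟩ := hx
      obtain ⟨hfin, hcard⟩ := hb (src g) (hH.src_mem hg) (src_src g)
      have hsub : {h ∈ H | src h = src g} ⊆ ginv '' {h ∈ H | rng h = src g} := fun h hh =>
        ⟨ginv h, ⟨hH.1 h hh.1, (rng_ginv h).trans hh.2⟩, ginv_ginv h⟩
      have hfin' := (hfin.image ginv).subset hsub
      have hcard' : {h ∈ H | src h = src g}.ncard ≤ M :=
        (Set.ncard_le_ncard hsub (hfin.image ginv)).trans
          ((Set.ncard_image_le hfin).trans hcard)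
      obtain ⟨f, -, hf⟩ := hfin'.exists_injOn_of_encard_le (t := (Set.univ : Set (Fin M))) (by
        rw [← hfin'.cast_ncard_eq, Set.encard_univ]
        simpa using hcard')
      exact ⟨f, hf⟩
    · exact ⟨fun _ => Classical.arbitrary _, fun g hg => (hx ⟨g, hg⟩).elim⟩
  choose f hf using key
  refine ⟨M, fun g => f (src g) g, fun g hg h hh hs hgh => ?_⟩
  dsimp only at hgh
  rw [hs] at hgh
  exact hf (src h) ⟨hg, hs⟩ ⟨hh, rfl⟩ hgh

/-- Finitely many subsets of a uniformly bounded subgroupoid generate a finite inverse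
semigroup. -/
theorem _root_.UniformlyBoundedSubgroupoid.finite_genInvSemigroup {H : Set G} (hH : IsSubgroupoid H)
    (hb : UniformlyBoundedSubgroupoid H) {X : Set (Set G)} (hX : X.Finite)
    (hXH : ∀ U ∈ X, U ⊆ H) : (genInvSemigroup X).Finite := by
  obtain ⟨M, e, he⟩ := hb.exists_label hH
  have := hX.to_subtype
  let type : G → X → Set (Fin M × Fin M) := fun x U => leftMulRel H e x U
  let S : Set (Set G) := {W | W ⊆ H ∧ ∀ x y, type x = type y →
    leftMulRel H e x W = leftMulRel H e y W}
  have hS : S.Finite := by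
    let F : Set G → (X → Set (Fin M × Fin M)) → Set (Fin M × Fin M) := fun W t =>
      {p | ∃ x, type x = t ∧ p ∈ leftMulRel H e x W}
    have hF : ∀ W ∈ S, ∀ x, F W (type x) = leftMulRel H e x W := by
      intro W hW x
      ext p
      constructor
      · rintro ⟨y, hy, hp⟩
        rwa [← hW.2 y x hy]
      · exact fun hp => ⟨x, rfl, hp⟩
    refine Set.Finite.of_injOn (f := F) (t := Set.univ) (fun _ _ => Set.mem_univ _) ?_
      Set.finite_univ
    intro V hV W hW hVW
    have hrel : ∀ x, leftMulRel H e x V = leftMulRel H e x W := fun x => by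
      rw [← hF V hV, ← hF W hW, hVW]
    exact (subset_of_leftMulRel_subset hH he hV.1 hW.1 fun x => (hrel x).subset).antisymm
      (subset_of_leftMulRel_subset hH he hW.1 hV.1 fun x => (hrel x).superset)
  refine hS.subset (genInvSemigroup_subset ?_ ?_ ?_)
  · exact fun U hU => ⟨hXH U hU, fun x y hxy => congrFun hxy ⟨U, hU⟩⟩
  · rintro U ⟨hU, hUt⟩
    refine ⟨?_, fun x y hxy => ?_⟩
    · rintro _ ⟨u, hu, rfl⟩
      exact hH.1 u (hU hu)
    · rw [leftMulRel_setInv hH e x hU, leftMulRel_setInv hH e y hU, hUt x y hxy]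
  · rintro U ⟨hU, hUt⟩ V ⟨hV, hVt⟩
    refine ⟨?_, fun x y hxy => ?_⟩
    · rintro _ ⟨u, hu, v, hv, huv, rfl⟩
      exact hH.2 u (hU hu) v (hV hv) huv
    · rw [leftMulRel_setMul hH he x hV, leftMulRel_setMul hH he y hV, hUt x y hxy,
        hVt x y hxy]

end Algebra

end TopologicalGroupoid

namespace AmpleGroupoid

variable {G : Type u} [AmpleGroupoid G]

/-- The source map with values in the unit space. -/
def srcUnit (g : G) : unitSpace G := ⟨src g, src_src g⟩

/-- The range map with values in the unit space. -/
def rngUnit (g : G) : unitSpace G := ⟨rng g, src_rng g⟩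

theorem isLocalHomeomorph_srcUnit : IsLocalHomeomorph (srcUnit : G → unitSpace G) :=
  isLocalHomeomorph_src

/-- Inversion as a homeomorphism. -/
def ginvHomeomorph (G : Type u) [AmpleGroupoid G] : G ≃ₜ G where
  toFun := ginv
  invFun := ginv
  left_inv := ginv_ginv
  right_inv := ginv_ginv
  continuous_toFun := continuous_ginv
  continuous_invFun := continuous_ginv

theorem rngUnit_eq : (rngUnit : G → unitSpace G) = srcUnit ∘ ginv :=
  funext fun g => Subtype.ext (src_ginv g).symm

theorem isLocalHomeomorph_rngUnit : IsLocalHomeomorph (rngUnit : G → unitSpace G) := by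
  rw [rngUnit_eq]
  exact isLocalHomeomorph_srcUnit.comp (ginvHomeomorph G).isLocalHomeomorph

theorem isOpen_setInv {U : Set G} (hU : IsOpen U) : IsOpen (setInv U) := by
  rw [setInv_eq_preimage]
  exact hU.preimage continuous_ginv

theorem isOpen_setMul {U V : Set G} (hU : IsOpen U) (hV : IsOpen V) : IsOpen (setMul U V) := by
  rw [isOpen_iff_mem_nhds]
  rintro _ ⟨u, hu, v, hv, huv, rfl⟩
  obtain ⟨φ, huφ, hφ⟩ := isLocalHomeomorph_rngUnit u
  have hrng : ∀ x ∈ φ.target, rng (φ.symm x) = x := fun x hx => by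
    have := φ.right_inv hx
    rw [← hφ] at this
    exact congrArg Subtype.val this
  let O : Set G := rngUnit ⁻¹' φ.target
  have hO : IsOpen O := φ.open_target.preimage isLocalHomeomorph_rngUnit.continuous
  have hcont : Continuous fun g : O => φ.symm (rngUnit g.1) :=
    φ.continuousOn_symm.comp_continuous
      (isLocalHomeomorph_rngUnit.continuous.comp continuous_subtype_val) fun g => g.2
  let q : O → {p : G × G // src p.1 = rng p.2} := fun g =>
    ⟨(ginv (φ.symm (rngUnit g.1)), g.1), by rw [src_ginv, hrng _ g.2]; rfl⟩
  have hq : Continuous q :=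
    ((continuous_ginv.comp hcont).prodMk continuous_subtype_val).subtype_mk _
  have hopen : IsOpen {g : O | φ.symm (rngUnit g.1) ∈ U ∧
      gmul (ginv (φ.symm (rngUnit g.1))) g.1 ∈ V} :=
    (hU.preimage hcont).inter (hV.preimage (continuous_gmul.comp hq))
  refine Filter.mem_of_superset ((hO.isOpenMap_subtype_val _ hopen).mem_nhds ?_) ?_
  · have hr : rngUnit (gmul u v) = φ u := by
      rw [← hφ]
      exact Subtype.ext (rng_gmul_comp u v huv)
    have hsymm : φ.symm (rngUnit (gmul u v)) = u := by rw [hr, φ.left_inv huφ]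
    refine ⟨⟨gmul u v, ?_⟩, ⟨?_, ?_⟩, rfl⟩
    · change rngUnit (gmul u v) ∈ φ.target
      rw [hr]
      exact φ.map_source huφ
    · simpa only [hsymm] using hu
    · simpa only [hsymm, ginv_gmul_gmul huv] using hv
  · rintro _ ⟨g, ⟨hgU, hgV⟩, rfl⟩
    have hr : rng (φ.symm (rngUnit g.1)) = rng g.1 := hrng _ g.2
    refine ⟨_, hgU, _, hgV, ?_, (gmul_ginv_gmul hr).symm⟩
    rw [rng_gmul_comp _ _ (by rw [src_ginv, hr]), rng_ginv]

theorem isCompact_setMul {U V : Set G} (hU : IsCompact U) (hV : IsCompact V) :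
    IsCompact (setMul U V) := by
  have := t2_unitSpace (G := G)
  let C : Set (G × G) := {p | src p.1 = rng p.2}
  have hC : IsClosed C := by
    have : C = {p : G × G | srcUnit p.1 = rngUnit p.2} := by
      ext p
      exact ⟨fun h => Subtype.ext h, fun h => congrArg Subtype.val h⟩
    rw [this]
    exact isClosed_eq (isLocalHomeomorph_srcUnit.continuous.comp continuous_fst)
      (isLocalHomeomorph_rngUnit.continuous.comp continuous_snd)
  have himage : setMul U V = (fun p : C => gmul p.1.1 p.1.2) '' (Subtype.val ⁻¹' U ×ˢ V) := by
    ext x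
    constructor
    · rintro ⟨u, hu, v, hv, huv, rfl⟩
      exact ⟨⟨(u, v), huv⟩, ⟨hu, hv⟩, rfl⟩
    · rintro ⟨⟨⟨u, v⟩, huv⟩, ⟨hu, hv⟩, rfl⟩
      exact ⟨u, hu, v, hv, huv, rfl⟩
  rw [himage]
  exact (hC.isClosedEmbedding_subtypeVal.isCompact_preimage (hU.prod hV)).image continuous_gmul

theorem t2Space_of_injOn_src {U : Set G} (hU : Set.InjOn (src : G → G) U) : T2Space U := by
  have := t2_unitSpace (G := G)
  exact T2Space.of_injective_continuous (f := fun u : U => srcUnit u.1)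
    (fun u v h => Subtype.ext (hU u.2 v.2 (congrArg Subtype.val h)))
    (isLocalHomeomorph_srcUnit.continuous.comp continuous_subtype_val)

theorem isCompactBisection_setInv {U : Set G} (hU : IsCompactBisection U) :
    IsCompactBisection (setInv U) :=
  have hs := injOn_src_setInv hU.1.2.2
  ⟨⟨isOpen_setInv hU.1.1, hs, injOn_rng_setInv hU.1.2.1⟩, hU.2.1.image continuous_ginv,
    t2Space_of_injOn_src hs⟩

theorem isCompactBisection_setMul {U V : Set G} (hU : IsCompactBisection U)
    (hV : IsCompactBisection V) : IsCompactBisection (setMul U V) :=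
  have hs := injOn_src_setMul hU.1.2.1 hV.1.2.1
  ⟨⟨isOpen_setMul hU.1.1 hV.1.1, hs, injOn_rng_setMul hU.1.2.2 hV.1.2.2⟩,
    isCompact_setMul hU.2.1 hV.2.1, t2Space_of_injOn_src hs⟩

theorem isCompactBisection_of_mem_genInvSemigroup {X : Set (Set G)}
    (hX : ∀ U ∈ X, IsCompactBisection U) {U : Set G} (hU : U ∈ genInvSemigroup X) :
    IsCompactBisection U :=
  genInvSemigroup_subset (S := {U | IsCompactBisection U}) hX
    (fun _ => isCompactBisection_setInv) (fun _ hU _ hV => isCompactBisection_setMul hU hV) hU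

theorem exists_isOpen_injOn_rng (g : G) :
    ∃ U : Set G, IsOpen U ∧ g ∈ U ∧ Set.InjOn (rng : G → G) U := by
  obtain ⟨φ, hg, hφ⟩ := isLocalHomeomorph_rngUnit g
  refine ⟨φ.source, φ.open_source, hg, fun u hu v hv h => φ.injOn hu hv ?_⟩
  rw [← hφ]
  exact Subtype.ext h

theorem exists_isCompactBisection_mem (g : G) : ∃ U : Set G, IsCompactBisection U ∧ g ∈ U := by
  have := t2_unitSpace (G := G)
  have := locallyCompact_unitSpace (G := G)
  have := totallyDisconnected_unitSpace (G := G)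
  obtain ⟨V, hVo, hgV, hV⟩ := exists_isOpen_injOn_rng g
  obtain ⟨φ, hg, hφ⟩ := isLocalHomeomorph_srcUnit g
  have hW : IsOpen (φ.target ∩ φ.symm ⁻¹' V) := φ.isOpen_inter_preimage_symm hVo
  obtain ⟨K, hK, hgK, hKW⟩ := exists_compact_subset hW
    (show φ g ∈ _ from ⟨φ.map_source hg, by rwa [Set.mem_preimage, φ.left_inv hg]⟩)
  obtain ⟨L, hL, hgL, hLK⟩ := loc_compact_Haus_tot_disc_of_zero_dim.exists_subset_of_mem_open
    hgK isOpen_interior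
  have hLK' : L ⊆ K := hLK.trans interior_subset
  have hLt : L ⊆ φ.target := fun x hx => (hKW (hLK' hx)).1
  have hs : Set.InjOn (src : G → G) (φ.symm '' L) := by
    rintro _ ⟨x, hx, rfl⟩ _ ⟨y, hy, rfl⟩ h
    refine φ.injOn (φ.map_target (hLt hx)) (φ.map_target (hLt hy)) ?_
    rw [← hφ]
    exact Subtype.ext h
  refine ⟨φ.symm '' L, ⟨⟨?_, hs, hV.mono ?_⟩, ?_, t2Space_of_injOn_src hs⟩,
    ⟨φ g, hgL, φ.left_inv hg⟩⟩
  · exact φ.isOpen_image_symm_of_subset_target hL.isOpen hLt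
  · rintro _ ⟨x, hx, rfl⟩
    exact (hKW (hLK' hx)).2
  · exact (hK.of_isClosed_subset hL.isClosed hLK').image_of_continuousOn
      (φ.continuousOn_symm.mono hLt)

theorem uniformlyBounded_of_isCompact {H : Set G} (hH : IsCompact H) :
    UniformlyBoundedSubgroupoid H := by
  choose U hUo hU hUinj using exists_isOpen_injOn_rng (G := G)
  obtain ⟨t, ht⟩ := hH.elim_finite_subcover U hUo fun g _ => Set.mem_iUnion.2 ⟨g, hU g⟩
  have hex : ∀ g : G, ∃ i, g ∈ H → i ∈ t ∧ g ∈ U i := fun g => by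
    by_cases hg : g ∈ H
    · obtain ⟨i, hi, hgi⟩ := Set.mem_iUnion₂.1 (ht hg)
      exact ⟨i, fun _ => ⟨hi, hgi⟩⟩
    · exact ⟨g, fun h => (hg h).elim⟩
  choose c hc using hex
  refine ⟨t.card + 1, Nat.le_add_left _ _, fun x _ _ => ?_⟩
  have hmaps : Set.MapsTo c {g ∈ H | rng g = x} (t : Set G) := fun g hg => (hc g hg.1).1
  have hinj : Set.InjOn c {g ∈ H | rng g = x} := fun g hg h hh hgh =>
    hUinj (c g) (hc g hg.1).2 (hgh ▸ (hc h hh.1).2) (hg.2.trans hh.2.symm)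
  refine ⟨Set.Finite.of_injOn hmaps hinj t.finite_toSet, ?_⟩
  calc _ ≤ (t : Set G).ncard := Set.ncard_le_ncard_of_injOn c hmaps hinj t.finite_toSet
    _ = t.card := Set.ncard_coe_finset t
    _ ≤ t.card + 1 := Nat.le_succ _

theorem finite_genInvSemigroup_of_directedOn_uniformlyBounded {𝒟 : Set (Set G)}
    (hdir : DirectedOn (· ⊆ ·) 𝒟)
    (h𝒟 : ∀ H ∈ 𝒟, IsOpen H ∧ IsSubgroupoid H ∧ UniformlyBoundedSubgroupoid H)
    (hcov : ⋃₀ 𝒟 = Set.univ) {X : Set (Set G)} (hX : X.Finite)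
    (hXc : ∀ U ∈ X, IsCompactBisection U) : (genInvSemigroup X).Finite := by
  rcases 𝒟.eq_empty_or_nonempty with rfl | hne
  · rw [Set.sUnion_empty, eq_comm, Set.univ_eq_empty_iff] at hcov
    exact Set.toFinite _
  · have := hne.to_subtype
    have hK : IsCompact (⋃₀ X) := hX.isCompact_sUnion fun U hU => (hXc U hU).2.1
    obtain ⟨⟨H, hH⟩, hXH⟩ := hK.elim_directed_cover (fun H : 𝒟 => (H : Set G))
      (fun H => (h𝒟 H H.2).1) (by rw [← Set.sUnion_eq_iUnion, hcov]; exact Set.subset_univ _)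
      hdir.directed_val
    exact (h𝒟 H hH).2.2.finite_genInvSemigroup (h𝒟 H hH).2.1 hX
      fun U hU => (Set.subset_sUnion_of_mem hU).trans hXH

theorem exists_directedOn_isCompact_of_finite_genInvSemigroup
    (h : ∀ X : Set (Set G), X.Finite → (∀ U ∈ X, IsCompactBisection U) →
      (genInvSemigroup X).Finite) :
    ∃ 𝒟 : Set (Set G), DirectedOn (· ⊆ ·) 𝒟 ∧
      (∀ H ∈ 𝒟, IsOpen H ∧ IsSubgroupoid H ∧ IsCompact H) ∧ ⋃₀ 𝒟 = Set.univ := by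
  refine ⟨(fun X => ⋃₀ genInvSemigroup X) ''
    {X : Set (Set G) | X.Finite ∧ ∀ U ∈ X, IsCompactBisection U}, ?_, ?_, ?_⟩
  · rintro _ ⟨X, ⟨hX, hXc⟩, rfl⟩ _ ⟨Y, ⟨hY, hYc⟩, rfl⟩
    exact ⟨_, ⟨X ∪ Y, ⟨hX.union hY, fun U hU => hU.elim (hXc U) (hYc U)⟩, rfl⟩,
      Set.sUnion_subset_sUnion (genInvSemigroup_mono Set.subset_union_left),
      Set.sUnion_subset_sUnion (genInvSemigroup_mono Set.subset_union_right)⟩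
  · rintro _ ⟨X, ⟨hX, hXc⟩, rfl⟩
    exact ⟨isOpen_sUnion fun U hU => (isCompactBisection_of_mem_genInvSemigroup hXc hU).1.1,
      isSubgroupoid_sUnion_genInvSemigroup X, (h X hX hXc).isCompact_sUnion fun U hU =>
        (isCompactBisection_of_mem_genInvSemigroup hXc hU).2.1⟩
  · refine Set.eq_univ_of_forall fun g => ?_
    obtain ⟨U, hU, hg⟩ := exists_isCompactBisection_mem g
    exact ⟨_, ⟨{U}, ⟨Set.finite_singleton U, fun V hV => hV ▸ hU⟩, rfl⟩, U,
      subset_genInvSemigroup _ rfl, hg⟩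

end AmpleGroupoid

/-- For an ample groupoid `𝒢` the following are equivalent:
(1) `𝒢` is a directed union of quasi-compact open subgroupoids;
(2) `𝒢` is a directed union of uniformly bounded open subgroupoids;
(3) the inverse semigroup of all compact bisections of `𝒢` is locally finite
(every finitely generated inverse subsemigroup is finite). -/
theorem directed_union_quasicompact_tfae (G : Type u) [AmpleGroupoid G] :
    ((∃ 𝒟 : Set (Set G), DirectedOn (· ⊆ ·) 𝒟 ∧
        (∀ H ∈ 𝒟, IsOpen H ∧ IsSubgroupoid H ∧ IsCompact H) ∧ ⋃₀ 𝒟 = Set.univ) ↔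
      (∃ 𝒟 : Set (Set G), DirectedOn (· ⊆ ·) 𝒟 ∧
        (∀ H ∈ 𝒟, IsOpen H ∧ IsSubgroupoid H ∧ UniformlyBoundedSubgroupoid H) ∧
        ⋃₀ 𝒟 = Set.univ)) ∧
    ((∃ 𝒟 : Set (Set G), DirectedOn (· ⊆ ·) 𝒟 ∧
        (∀ H ∈ 𝒟, IsOpen H ∧ IsSubgroupoid H ∧ IsCompact H) ∧ ⋃₀ 𝒟 = Set.univ) ↔
      (∀ X : Set (Set G), X.Finite → (∀ U ∈ X, IsCompactBisection U) →
        (genInvSemigroup X).Finite)) := by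
  have h12 : (∃ 𝒟 : Set (Set G), DirectedOn (· ⊆ ·) 𝒟 ∧
        (∀ H ∈ 𝒟, IsOpen H ∧ IsSubgroupoid H ∧ IsCompact H) ∧ ⋃₀ 𝒟 = Set.univ) →
      (∃ 𝒟 : Set (Set G), DirectedOn (· ⊆ ·) 𝒟 ∧
        (∀ H ∈ 𝒟, IsOpen H ∧ IsSubgroupoid H ∧ UniformlyBoundedSubgroupoid H) ∧
        ⋃₀ 𝒟 = Set.univ) := fun ⟨𝒟, hdir, h𝒟, hcov⟩ =>
    ⟨𝒟, hdir, fun H hH => ⟨(h𝒟 H hH).1, (h𝒟 H hH).2.1,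
      AmpleGroupoid.uniformlyBounded_of_isCompact (h𝒟 H hH).2.2⟩, hcov⟩
  have h23 : (∃ 𝒟 : Set (Set G), DirectedOn (· ⊆ ·) 𝒟 ∧
        (∀ H ∈ 𝒟, IsOpen H ∧ IsSubgroupoid H ∧ UniformlyBoundedSubgroupoid H) ∧
        ⋃₀ 𝒟 = Set.univ) →
      (∀ X : Set (Set G), X.Finite → (∀ U ∈ X, IsCompactBisection U) →
        (genInvSemigroup X).Finite) := fun ⟨_, hdir, h𝒟, hcov⟩ _ hX hXc =>
    AmpleGroupoid.finite_genInvSemigroup_of_directedOn_uniformlyBounded hdir h𝒟 hcov hX hXc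
  have h31 := AmpleGroupoid.exists_directedOn_isCompact_of_finite_genInvSemigroup (G := G)
  exact ⟨⟨h12, fun h => h31 (h23 h)⟩, ⟨fun h => h23 (h12 h), h31⟩⟩
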